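/- arXiv:1108.5949 — 2 statements merged into one kernel-verified Lean document; each statement's English description precedes it below -/
import Mathlib

section
/- Let k ≥ 3 and let G = C_k ∘ P_2 be the 2-corona of the cycle C_k. If v is a vertex of G of degree 2, then γta(G;v) = γt(G) − 1. -/
open SimpleGraph

/-- The total domination number of a finite simple graph `G`: the minimum size of a set `S`
of vertices such that every vertex of `G` has a neighbor in `S`. -/
noncomputable def totalDominationNumber {V : Type*} [Fintype V] (G : SimpleGraph V) : ℕ :=
  sInf {n | ∃ S : Finset V, S.card = n ∧ ∀ v : V, ∃ u ∈ S, G.Adj v u}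

/-- The almost total domination number of `G` with respect to `v`: the minimum size of a set
`S` with `v ∈ S`, `v` having no neighbor in `S`, and every vertex other than `v` having a
neighbor in `S`. -/
noncomputable def almostTotalDominationNumber {V : Type*} [Fintype V] (G : SimpleGraph V)
    (v : V) : ℕ :=
  sInf {n | ∃ S : Finset V, S.card = n ∧ v ∈ S ∧ (∀ u ∈ S, ¬ G.Adj v u) ∧
    ∀ w : V, w ≠ v → ∃ u ∈ S, G.Adj w u}

/-- The graph obtained from `G` by deleting the vertex `v` and all incident edges. -/
def deleteVert {V : Type*} (G : SimpleGraph V) (v : V) : SimpleGraph {w : V // w ≠ v} :=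
  G.induce {w : V | w ≠ v}

/-- The cycle `C_n` on vertex set `Fin n`. -/
def cycleG (n : ℕ) : SimpleGraph (Fin n) :=
  SimpleGraph.fromRel (fun p q => (q : ℕ) = ((p : ℕ) + 1) % n)

/-- The 2-corona `C_k ∘ P_2` of the cycle `C_k`.  Vertex `(0, i)` is the cycle vertex `x_i`,
`(1, i)` is `x_i'` and `(2, i)` is `x_i''`, with pendant path `x_i x_i' x_i''`. -/
def coronaRel (k : ℕ) (p q : Fin 3 × Fin k) : Prop :=
  (p.1 = 0 ∧ q.1 = 0 ∧ (q.2 : ℕ) = ((p.2 : ℕ) + 1) % k) ∨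
  (p.1 = 0 ∧ q.1 = 1 ∧ p.2 = q.2) ∨
  (p.1 = 1 ∧ q.1 = 2 ∧ p.2 = q.2)

def coronaGraph (k : ℕ) : SimpleGraph (Fin 3 × Fin k) :=
  SimpleGraph.fromRel (coronaRel k)

/-- The edges of `G_k` common to `G_k`, `H_k`, `F_k`, `L_k` (0-indexed: `(0,i) = a_{i+1}`,
`(1,i) = b_{i+1}`, `(2,i) = c_{i+1}`, `(3,i) = d_{i+1}`): the two paths
`a_1 b_1 a_2 b_2 … a_k b_k` and `c_1 d_1 c_2 d_2 … c_k d_k`, and the edges `a_i d_i`,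
`b_i c_i`. -/
def gkBase (k : ℕ) (p q : Fin 4 × Fin k) : Prop :=
  (p.1 = 0 ∧ q.1 = 1 ∧ p.2 = q.2) ∨
  (p.1 = 1 ∧ q.1 = 0 ∧ (p.2 : ℕ) + 1 = (q.2 : ℕ)) ∨
  (p.1 = 2 ∧ q.1 = 3 ∧ p.2 = q.2) ∨
  (p.1 = 3 ∧ q.1 = 2 ∧ (p.2 : ℕ) + 1 = (q.2 : ℕ)) ∨
  (p.1 = 0 ∧ q.1 = 3 ∧ p.2 = q.2) ∨
  (p.1 = 1 ∧ q.1 = 2 ∧ p.2 = q.2)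

/-- The cubic graph `G_k`: the base edges together with `a_1 c_1` and `b_k d_k`. -/
def gkRel (k : ℕ) (p q : Fin 4 × Fin k) : Prop :=
  gkBase k p q ∨
  (p.1 = 0 ∧ q.1 = 2 ∧ (p.2 : ℕ) = 0 ∧ (q.2 : ℕ) = 0) ∨
  (p.1 = 1 ∧ q.1 = 3 ∧ (p.2 : ℕ) = k - 1 ∧ (q.2 : ℕ) = k - 1)

def GkGraph (k : ℕ) : SimpleGraph (Fin 4 × Fin k) :=
  SimpleGraph.fromRel (gkRel k)

/-- The cubic graph `H_k`: the base edges together with `a_1 b_k` and `c_1 d_k`. -/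
def hkRel (k : ℕ) (p q : Fin 4 × Fin k) : Prop :=
  gkBase k p q ∨
  (p.1 = 0 ∧ q.1 = 1 ∧ (p.2 : ℕ) = 0 ∧ (q.2 : ℕ) = k - 1) ∨
  (p.1 = 2 ∧ q.1 = 3 ∧ (p.2 : ℕ) = 0 ∧ (q.2 : ℕ) = k - 1)

def HkGraph (k : ℕ) : SimpleGraph (Fin 4 × Fin k) :=
  SimpleGraph.fromRel (hkRel k)

/-- Vertices of `F_k`: the vertices of `G_k` together with `v_1, v_2, v_3`
(encoded `Sum.inr 0`, `Sum.inr 1`, `Sum.inr 2`). -/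
abbrev FkVert (k : ℕ) := (Fin 4 × Fin k) ⊕ Fin 3

/-- `F_k` is obtained from `G_k` by subdividing the edge `a_1 c_1` three times,
giving the path `a_1 v_1 v_2 v_3 c_1`. -/
def fkRel (k : ℕ) (p q : FkVert k) : Prop :=
  match p, q with
  | Sum.inl p, Sum.inl q =>
      gkBase k p q ∨
      (p.1 = 1 ∧ q.1 = 3 ∧ (p.2 : ℕ) = k - 1 ∧ (q.2 : ℕ) = k - 1)
  | Sum.inl p, Sum.inr j =>
      (p.1 = 0 ∧ (p.2 : ℕ) = 0 ∧ j = 0) ∨ (p.1 = 2 ∧ (p.2 : ℕ) = 0 ∧ j = 2)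
  | Sum.inr i, Sum.inr j => (j : ℕ) = (i : ℕ) + 1
  | Sum.inr _, Sum.inl _ => False

def FkGraph (k : ℕ) : SimpleGraph (FkVert k) :=
  SimpleGraph.fromRel (fkRel k)

/-- Vertices of `L_k`: the vertices of `G_k` together with `v_1, v_2, v_3`
(encoded `Sum.inr (0, j)`) and `u_1, u_2, u_3` (encoded `Sum.inr (1, j)`). -/
abbrev LkVert (k : ℕ) := (Fin 4 × Fin k) ⊕ (Fin 2 × Fin 3)

/-- `L_k` is obtained from `G_k` by subdividing the edge `a_1 c_1` three times (path
`a_1 v_1 v_2 v_3 c_1`) and the edge `b_k d_k` three times (path `b_k u_1 u_2 u_3 d_k`). -/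
def lkRel (k : ℕ) (p q : LkVert k) : Prop :=
  match p, q with
  | Sum.inl p, Sum.inl q => gkBase k p q
  | Sum.inl p, Sum.inr j =>
      (p.1 = 0 ∧ (p.2 : ℕ) = 0 ∧ j = ((0 : Fin 2), (0 : Fin 3))) ∨
      (p.1 = 2 ∧ (p.2 : ℕ) = 0 ∧ j = ((0 : Fin 2), (2 : Fin 3))) ∨
      (p.1 = 1 ∧ (p.2 : ℕ) = k - 1 ∧ j = ((1 : Fin 2), (0 : Fin 3))) ∨
      (p.1 = 3 ∧ (p.2 : ℕ) = k - 1 ∧ j = ((1 : Fin 2), (2 : Fin 3)))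
  | Sum.inr i, Sum.inr j => i.1 = j.1 ∧ (j.2 : ℕ) = (i.2 : ℕ) + 1
  | Sum.inr _, Sum.inl _ => False

def LkGraph (k : ℕ) : SimpleGraph (LkVert k) :=
  SimpleGraph.fromRel (lkRel k)

/-- The generalized Petersen graph `GP(8,3)` of order 16: `(0, i) = u_i`, `(1, i) = w_i`. -/
def gpRel (p q : Fin 2 × Fin 8) : Prop :=
  (p.1 = 0 ∧ q.1 = 0 ∧ (q.2 : ℕ) = ((p.2 : ℕ) + 1) % 8) ∨
  (p.1 = 0 ∧ q.1 = 1 ∧ p.2 = q.2) ∨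
  (p.1 = 1 ∧ q.1 = 1 ∧ (q.2 : ℕ) = ((p.2 : ℕ) + 3) % 8)

def GP16 : SimpleGraph (Fin 2 × Fin 8) :=
  SimpleGraph.fromRel gpRel

theorem coronaGraph_adj_one_iff {k : ℕ} {i : Fin k} {w : Fin 3 × Fin k} :
    (coronaGraph k).Adj (1, i) w ↔ w = (0, i) ∨ w = (2, i) := by
  obtain ⟨a, j⟩ := w
  fin_cases a <;> simp [coronaGraph, coronaRel, eq_comm]

theorem coronaGraph_adj_two_iff {k : ℕ} {i : Fin k} {w : Fin 3 × Fin k} :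
    (coronaGraph k).Adj (2, i) w ↔ w = (1, i) := by
  obtain ⟨a, j⟩ := w
  fin_cases a <;> simp [coronaGraph, coronaRel, eq_comm]

theorem coronaGraph_adj_zero_one {k : ℕ} (i : Fin k) :
    (coronaGraph k).Adj (0, i) (1, i) :=
  (coronaGraph_adj_one_iff.2 (Or.inl rfl)).symm

theorem coronaGraph_adj_zero_zero {k : ℕ} {i j : Fin k} (hij : i ≠ j)
    (h : (j : ℕ) = ((i : ℕ) + 1) % k) : (coronaGraph k).Adj (0, i) (0, j) := by
  simp [coronaGraph, coronaRel, hij, h]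

theorem two_lt_ncard_neighborSet_coronaGraph_zero {k : ℕ} (hk : 3 ≤ k) (i : Fin k) :
    2 < ((coronaGraph k).neighborSet (0, i)).ncard := by
  obtain ⟨j, hj, hij⟩ : ∃ j : Fin k, (j : ℕ) = ((i : ℕ) + 1) % k ∧
      ((j : ℕ) = i + 1 ∨ ((i : ℕ) + 1 = k ∧ (j : ℕ) = 0)) := by
    rcases Nat.lt_or_ge (i + 1) k with h | h
    · exact ⟨⟨i + 1, h⟩, (Nat.mod_eq_of_lt h).symm, Or.inl rfl⟩
    · have h' : (i : ℕ) + 1 = k := by omega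
      exact ⟨⟨0, by omega⟩, by simp [h'], Or.inr ⟨h', rfl⟩⟩
  obtain ⟨p, hp, hip⟩ : ∃ p : Fin k, (i : ℕ) = ((p : ℕ) + 1) % k ∧
      ((i : ℕ) = p + 1 ∨ ((p : ℕ) + 1 = k ∧ (i : ℕ) = 0)) := by
    rcases Nat.eq_zero_or_pos (i : ℕ) with h | h
    · refine ⟨⟨k - 1, by omega⟩, ?_, Or.inr ⟨?_, h⟩⟩
      · simp [h, Nat.sub_add_cancel (by omega : 1 ≤ k)]
      · simp only
        omega
    · have h' : (i : ℕ) - 1 + 1 = i := by omega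
      refine ⟨⟨i - 1, by omega⟩, ?_, Or.inl h'.symm⟩
      simp [h', Nat.mod_eq_of_lt i.isLt]
  have hne : i ≠ j := fun h => by have := congrArg Fin.val h; omega
  have hne' : p ≠ i := fun h => by have := congrArg Fin.val h; omega
  have hpj : j ≠ p := fun h => by have := congrArg Fin.val h; omega
  rw [Set.two_lt_ncard_iff (Set.toFinite _)]
  exact ⟨(1, i), (0, j), (0, p), coronaGraph_adj_zero_one i, coronaGraph_adj_zero_zero hne hj,
    (coronaGraph_adj_zero_zero hne' hp).symm, by simp, by simp, by simp [hpj]⟩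

theorem fst_eq_one_of_ncard_neighborSet_coronaGraph {k : ℕ} (hk : 3 ≤ k) {v : Fin 3 × Fin k}
    (hv : ((coronaGraph k).neighborSet v).ncard = 2) : v.1 = 1 := by
  obtain ⟨a, i⟩ := v
  have h₀ := two_lt_ncard_neighborSet_coronaGraph_zero hk i
  have h₂ : ((coronaGraph k).neighborSet (2, i)).ncard = 1 := by
    rw [Set.ncard_eq_one]
    exact ⟨(1, i), Set.ext fun w => coronaGraph_adj_two_iff⟩
  have ha : a ≠ 0 := by
    rintro rfl
    omega
  have ha' : a ≠ 2 := by
    rintro rfl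
    omega
  change a = 1
  omega

theorem add_card_le_card_of_corona_columns {k : ℕ} {S : Finset (Fin 3 × Fin k)}
    {T : Finset (Fin k)} (h₁ : ∀ i, (1, i) ∈ S) (h : ∀ i ∈ T, (0, i) ∈ S ∨ (2, i) ∈ S) :
    k + T.card ≤ S.card := by
  classical
  rw [← Finset.card_filter_add_card_filter_not (s := S) (fun w => w.1 = 1)]
  refine Nat.add_le_add ?_ ?_
  · calc k = (Finset.univ : Finset (Fin k)).card := (Finset.card_fin k).symm
      _ ≤ ((S.filter fun w => w.1 = 1).image Prod.snd).card :=
        Finset.card_le_card fun i _ => Finset.mem_image.2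
          ⟨(1, i), Finset.mem_filter.2 ⟨h₁ i, rfl⟩, rfl⟩
      _ ≤ _ := Finset.card_image_le
  · calc T.card ≤ ((S.filter fun w => ¬ w.1 = 1).image Prod.snd).card := by
          refine Finset.card_le_card fun i hi => Finset.mem_image.2 ?_
          rcases h i hi with h' | h'
          · exact ⟨(0, i), Finset.mem_filter.2 ⟨h', by simp⟩, rfl⟩
          · exact ⟨(2, i), Finset.mem_filter.2 ⟨h', by simp⟩, rfl⟩
      _ ≤ _ := Finset.card_image_le

theorem mem_or_mem_of_coronaGraph_adj_one {k : ℕ} {S : Finset (Fin 3 × Fin k)} {i : Fin k}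
    (h : ∃ u ∈ S, (coronaGraph k).Adj (1, i) u) : (0, i) ∈ S ∨ (2, i) ∈ S := by
  obtain ⟨u, hu, hadj⟩ := h
  rcases coronaGraph_adj_one_iff.1 hadj with rfl | rfl
  exacts [Or.inl hu, Or.inr hu]

theorem mem_of_coronaGraph_adj_two {k : ℕ} {S : Finset (Fin 3 × Fin k)} {i : Fin k}
    (h : ∃ u ∈ S, (coronaGraph k).Adj (2, i) u) : (1, i) ∈ S := by
  obtain ⟨u, hu, hadj⟩ := h
  rwa [← coronaGraph_adj_two_iff.1 hadj]

theorem totalDominationNumber_coronaGraph (k : ℕ) :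
    totalDominationNumber (coronaGraph k) = 2 * k := by
  refine IsLeast.csInf_eq ⟨⟨{0, 1} ×ˢ Finset.univ, by simp, ?_⟩, ?_⟩
  · rintro ⟨a, i⟩
    fin_cases a
    · exact ⟨(1, i), by simp, coronaGraph_adj_zero_one i⟩
    · exact ⟨(0, i), by simp, (coronaGraph_adj_zero_one i).symm⟩
    · exact ⟨(1, i), by simp, coronaGraph_adj_two_iff.2 rfl⟩
  · rintro _ ⟨S, rfl, hS⟩
    have := add_card_le_card_of_corona_columns (S := S) (T := Finset.univ)
      (fun i => mem_of_coronaGraph_adj_two (hS _))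
      (fun i _ => mem_or_mem_of_coronaGraph_adj_one (hS _))
    rw [Finset.card_fin] at this
    omega

theorem almostTotalDominationNumber_coronaGraph_one {k : ℕ} (i : Fin k) :
    almostTotalDominationNumber (coronaGraph k) (1, i) = 2 * k - 1 := by
  refine IsLeast.csInf_eq
    ⟨⟨({0, 1} ×ˢ Finset.univ).erase (0, i), by simp, by simp, ?_, ?_⟩, ?_⟩
  · intro u hu hadj
    rcases coronaGraph_adj_one_iff.1 hadj with rfl | rfl <;> simp at hu
  · rintro ⟨a, j⟩ hw
    fin_cases a
    · exact ⟨(1, j), by simp, coronaGraph_adj_zero_one j⟩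
    · have hji : j ≠ i := fun h => hw (by simp [h])
      exact ⟨(0, j), by simp [hji], (coronaGraph_adj_zero_one j).symm⟩
    · exact ⟨(1, j), by simp, coronaGraph_adj_two_iff.2 rfl⟩
  · rintro _ ⟨S, rfl, -, -, hS⟩
    have := add_card_le_card_of_corona_columns (S := S) (T := Finset.univ.erase i)
      (fun j => mem_of_coronaGraph_adj_two (hS _ (by simp)))
      (fun j hj => mem_or_mem_of_coronaGraph_adj_one
        (hS _ (by simpa using Finset.ne_of_mem_erase hj)))
    rw [Finset.card_erase_of_mem (Finset.mem_univ i), Finset.card_fin] at this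
    omega

/-- For `k ≥ 3`, `G = C_k ∘ P_2` and a vertex `v` of degree 2,
`γta(G; v) = γt(G) − 1`. -/
theorem almostTotalDominationNumber_corona_of_degree_two (k : ℕ) (hk : 3 ≤ k)
    (v : Fin 3 × Fin k) (hv : ((coronaGraph k).neighborSet v).ncard = 2) :
    almostTotalDominationNumber (coronaGraph k) v =
      totalDominationNumber (coronaGraph k) - 1 := by
  obtain ⟨a, i⟩ := v
  obtain rfl : a = 1 := fst_eq_one_of_ncard_neighborSet_coronaGraph hk hv
  rw [almostTotalDominationNumber_coronaGraph_one, totalDominationNumber_coronaGraph]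
end

section
/- For every integer k ≥ 0, the graph F_k of order n = 4k + 3 has total domination number γt(F_k) = (n + 1)/2 = 2k + 2. -/
open SimpleGraph

/-- Lower bound on the weight of a total dominating set of a chain of `k` cells with entries
`a i, c i` and exits `b (i + 1), d (i + 1)`.  The Boolean `e i` records whether the exits of the
preceding cell are already dominated from within that cell. -/
theorem two_mul_add_potential_le_sum (a b c d e : ℕ → Bool) (h₀ : b 0 || d 0) (k : ℕ)
    (he : ∀ i < k, e (i + 1) = (a i || c i))
    (hea : ∀ i < k, e i || a i) (hec : ∀ i < k, e i || c i)
    (hb : ∀ i < k, b i || b (i + 1) || d (i + 1))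
    (hd : ∀ i < k, d i || b (i + 1) || d (i + 1)) :
    2 * k + (max ((b k).toNat + (d k).toNat) 1 + (e k).toNat) ≤
      (b 0).toNat + (d 0).toNat + (e 0).toNat +
        ∑ i ∈ Finset.range k,
          ((a i).toNat + (b (i + 1)).toNat + (c i).toNat + (d (i + 1)).toNat) := by
  induction k with
  | zero =>
    revert h₀
    cases b 0 <;> cases d 0 <;> simp
  | succ k ih =>
    have ih := ih (fun i hi => he i (by omega)) (fun i hi => hea i (by omega))
      (fun i hi => hec i (by omega)) (fun i hi => hb i (by omega)) (fun i hi => hd i (by omega))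
    have he' := he k (by omega)
    have hea' := hea k (by omega)
    have hec' := hec k (by omega)
    have hb' := hb k (by omega)
    have hd' := hd k (by omega)
    rw [Finset.sum_range_succ, he']
    revert ih hea' hec' hb' hd'
    generalize (∑ i ∈ Finset.range k,
      ((a i).toNat + (b (i + 1)).toNat + (c i).toNat + (d (i + 1)).toNat)) = s
    cases a k <;> cases c k <;> cases e k <;> cases b k <;> cases d k <;>
      cases b (k + 1) <;> cases d (k + 1) <;> simp <;> omega

/-- The indicator of `S` on the `j`-th vertex of the `i`-th cell, extended by `false`. -/
noncomputable def cellIndicator {k : ℕ} (S : Finset (FkVert k)) (j : Fin 4) (i : ℕ) : Bool :=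
  open Classical in decide (∃ h : i < k, Sum.inl (j, ⟨i, h⟩) ∈ S)

theorem cellIndicator_of_mem {k : ℕ} {S : Finset (FkVert k)} {j : Fin 4} {i : Fin k}
    (h : Sum.inl (j, i) ∈ S) : cellIndicator S j i = true := by
  simpa [cellIndicator] using h

theorem card_eq_sum_cellIndicator {k : ℕ} (S : Finset (FkVert k)) :
    S.card = (decide (Sum.inr 0 ∈ S)).toNat + (decide (Sum.inr 2 ∈ S)).toNat +
      (decide (Sum.inr 1 ∈ S)).toNat +
        ∑ i ∈ Finset.range k, ((cellIndicator S 0 i).toNat + (cellIndicator S 1 i).toNat +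
          (cellIndicator S 2 i).toNat + (cellIndicator S 3 i).toNat) := by
  have hS : S.card = ∑ v : FkVert k, (decide (v ∈ S)).toNat := by
    simp [Bool.toNat, Bool.cond_decide]
  have hc (j : Fin 4) : ∑ i ∈ Finset.range k, (cellIndicator S j i).toNat =
      ∑ i : Fin k, (decide (Sum.inl (j, i) ∈ S)).toNat := by
    rw [← Fin.sum_univ_eq_sum_range (fun i => (cellIndicator S j i).toNat)]
    simp [cellIndicator]
  rw [hS, Fintype.sum_sum_type, Fintype.sum_prod_type, Fin.sum_univ_four, Fin.sum_univ_three]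
  simp only [Finset.sum_add_distrib, hc]
  ring

theorem le_card_of_totalDominating {k : ℕ} (hk : 1 ≤ k) (S : Finset (FkVert k))
    (hS : ∀ v, ∃ u ∈ S, (FkGraph k).Adj v u) : 2 * k + 2 ≤ S.card := by
  obtain ⟨b, hb₀, hbs⟩ : ∃ b : ℕ → Bool, b 0 = decide (Sum.inr 0 ∈ S) ∧
      ∀ i, b (i + 1) = cellIndicator S 1 i :=
    ⟨fun i => i.casesOn (decide (Sum.inr 0 ∈ S)) (cellIndicator S 1), rfl, fun _ => rfl⟩
  obtain ⟨d, hd₀, hds⟩ : ∃ d : ℕ → Bool, d 0 = decide (Sum.inr 2 ∈ S) ∧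
      ∀ i, d (i + 1) = cellIndicator S 3 i :=
    ⟨fun i => i.casesOn (decide (Sum.inr 2 ∈ S)) (cellIndicator S 3), rfl, fun _ => rfl⟩
  obtain ⟨e, he₀, hes⟩ : ∃ e : ℕ → Bool, e 0 = decide (Sum.inr 1 ∈ S) ∧
      ∀ i, e (i + 1) = (cellIndicator S 0 i || cellIndicator S 2 i) :=
    ⟨fun i => i.casesOn (decide (Sum.inr 1 ∈ S)) fun i =>
      cellIndicator S 0 i || cellIndicator S 2 i, rfl, fun _ => rfl⟩
  have hv : b 0 || d 0 := by
    obtain ⟨⟨j, l⟩ | j, hu, h⟩ := hS (Sum.inr 1) <;> fin_cases j <;>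
      simp_all [FkGraph, fkRel]
  have hmem {j : Fin 4} {i : ℕ} {hi : i < k} (h : Sum.inl (j, ⟨i, hi⟩) ∈ S) :
      cellIndicator S j i = true := cellIndicator_of_mem h
  have hea (i : ℕ) (hi : i < k) : e i || cellIndicator S 0 i := by
    cases i with
    | zero =>
      obtain ⟨⟨j, l, hl⟩ | j, hu, h⟩ := hS (Sum.inr 0) <;> fin_cases j <;>
        simp [FkGraph, fkRel] at hu h <;> grind
    | succ i =>
      obtain ⟨⟨j, l, hl⟩ | j, hu, h⟩ := hS (Sum.inl (1, ⟨i, by omega⟩)) <;> fin_cases j <;>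
        simp [FkGraph, fkRel, gkBase] at hu h <;> grind
  have hec (i : ℕ) (hi : i < k) : e i || cellIndicator S 2 i := by
    cases i with
    | zero =>
      obtain ⟨⟨j, l, hl⟩ | j, hu, h⟩ := hS (Sum.inr 2) <;> fin_cases j <;>
        simp [FkGraph, fkRel] at hu h <;> grind
    | succ i =>
      obtain ⟨⟨j, l, hl⟩ | j, hu, h⟩ := hS (Sum.inl (3, ⟨i, by omega⟩)) <;> fin_cases j <;>
        simp [FkGraph, fkRel, gkBase] at hu h <;> grind
  have hb (i : ℕ) (hi : i < k) : b i || b (i + 1) || d (i + 1) := by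
    obtain ⟨⟨j, l, hl⟩ | j, hu, h⟩ := hS (Sum.inl (0, ⟨i, hi⟩)) <;> fin_cases j <;>
      simp [FkGraph, fkRel, gkBase] at hu h <;> grind
  have hd (i : ℕ) (hi : i < k) : d i || b (i + 1) || d (i + 1) := by
    obtain ⟨⟨j, l, hl⟩ | j, hu, h⟩ := hS (Sum.inl (2, ⟨i, hi⟩)) <;> fin_cases j <;>
      simp [FkGraph, fkRel, gkBase] at hu h <;> grind
  have hlast : e k || (b k && d k) := by
    obtain ⟨m, rfl⟩ : ∃ m, k = m + 1 := ⟨k - 1, by omega⟩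
    have hd : e (m + 1) || d (m + 1) := by
      obtain ⟨⟨j, l, hl⟩ | j, hu, h⟩ := hS (Sum.inl (1, ⟨m, by omega⟩)) <;> fin_cases j <;>
        simp [FkGraph, fkRel, gkBase] at hu h <;> grind
    have hb : e (m + 1) || b (m + 1) := by
      obtain ⟨⟨j, l, hl⟩ | j, hu, h⟩ := hS (Sum.inl (3, ⟨m, by omega⟩)) <;> fin_cases j <;>
        simp [FkGraph, fkRel, gkBase] at hu h <;> grind
    grind
  have hsum := two_mul_add_potential_le_sum (cellIndicator S 0) b (cellIndicator S 2) d e hv k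
    (fun i _ => hes i) hea hec hb hd
  have hcard : S.card = (b 0).toNat + (d 0).toNat + (e 0).toNat + ∑ i ∈ Finset.range k,
      ((cellIndicator S 0 i).toNat + (b (i + 1)).toNat + (cellIndicator S 2 i).toNat +
        (d (i + 1)).toNat) := by
    simp only [hb₀, hd₀, he₀, hbs, hds, card_eq_sum_cellIndicator S]
  rw [← hcard] at hsum
  refine le_trans ?_ hsum
  revert hlast
  cases e k <;> cases b k <;> cases d k <;> simp

theorem exists_totalDominating_card (k : ℕ) :
    ∃ S : Finset (FkVert k), S.card = 2 * k + 2 ∧ ∀ v, ∃ u ∈ S, (FkGraph k).Adj v u := by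
  refine ⟨(({1, 2} : Finset (Fin 4)) ×ˢ Finset.univ).disjSum {0, 1}, by simp, ?_⟩
  rintro (⟨j, i⟩ | j)
  · fin_cases j
    · exact ⟨Sum.inl (1, i), by simp, by simp [FkGraph, fkRel, gkBase]⟩
    · exact ⟨Sum.inl (2, i), by simp, by simp [FkGraph, fkRel, gkBase]⟩
    · exact ⟨Sum.inl (1, i), by simp, by simp [FkGraph, fkRel, gkBase]⟩
    · exact ⟨Sum.inl (2, i), by simp, by simp [FkGraph, fkRel, gkBase]⟩
  · fin_cases j
    · exact ⟨Sum.inr 1, by simp, by simp [FkGraph, fkRel]⟩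
    · exact ⟨Sum.inr 0, by simp, by simp [FkGraph, fkRel]⟩
    · exact ⟨Sum.inr 1, by simp, by simp [FkGraph, fkRel]⟩

theorem totalDominationNumber_eq {V : Type*} [Fintype V] {G : SimpleGraph V} {n : ℕ}
    (hex : ∃ S : Finset V, S.card = n ∧ ∀ v, ∃ u ∈ S, G.Adj v u)
    (hle : ∀ S : Finset V, (∀ v, ∃ u ∈ S, G.Adj v u) → n ≤ S.card) :
    totalDominationNumber G = n :=
  IsLeast.csInf_eq ⟨hex, by rintro _ ⟨S, rfl, hS⟩; exact hle S hS⟩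

theorem totalDominationNumber_cycleG_three : totalDominationNumber (cycleG 3) = 2 := by
  apply totalDominationNumber_eq
  · refine ⟨{0, 1}, rfl, ?_⟩
    simp only [cycleG, SimpleGraph.fromRel_adj]
    decide
  · simp only [cycleG, SimpleGraph.fromRel_adj]
    decide

/-- For every `k ≥ 0`, the graph `F_k` of order `n = 4k + 3` has total domination number
`(n + 1)/2 = 2k + 2`  (here `F_0` is the 3-cycle `C_3`). -/
theorem totalDominationNumber_Fk (k : ℕ) :
    (k = 0 → totalDominationNumber (cycleG 3) = 2 * k + 2) ∧
    (1 ≤ k → totalDominationNumber (FkGraph k) = 2 * k + 2) := by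
  refine ⟨?_, fun hk => totalDominationNumber_eq (exists_totalDominating_card k)
    (le_card_of_totalDominating hk)⟩
  rintro rfl
  exact totalDominationNumber_cycleG_three
end
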